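/- (Main Lemma (ii)) Let e=(u,v) be a non-leaf-edge of depth d−1 in a rooted tree instance, assume all edges of depth at least d satisfy conditions (a) and (b), and let ⟨ã,b̃⟩ = Ψ(e1)⊗Ψ(e2) for the two child-edges e1, e2 of e. If c(e) < ã then one of e1, e2 is dominating. Moreover, if e1 (say) is dominating, then there is a terminal t* ∈ T_{e1} such that g(u,t*) ≥ min{ã, c(e)} for every decomposition g of every blocking flow of I(e), and the path P_{v,t*} is a dominating path; in particular e satisfies condition (b). -/

import Mathlib

open Classical

/-- `⟨a,b⟩`: the set `{a, a+2, …, b}` of consecutive odd or even integers. -/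
def Iv (a b : ℕ) : Set ℕ := {x | a ≤ x ∧ x ≤ b ∧ x % 2 = a % 2}

/-- `A ⊗ B = {a + b − 2i : a ∈ A, b ∈ B, 0 ≤ i ≤ min(a,b)}`. -/
def otimes (A B : Set ℕ) : Set ℕ :=
  {x | ∃ a ∈ A, ∃ b ∈ B, ∃ i, i ≤ min a b ∧ x = a + b - 2 * i}

/-- A tree instance `(G,T,c)` rooted at a terminal `r`: a tree on vertex set `V`,
encoded by the parent function `par` (with `par root = root`) together with a depth
function certifying acyclicity.  Each non-root vertex `v` is identified with the edge
`(par v, v)`; `c v` is the (positive integer) capacity of that edge.  The terminals are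
the leaves; the root has exactly one child and every internal vertex has exactly
two children (total degree 3). -/
structure RTI (V : Type*) where
  root : V
  par : V → V
  dep : V → ℕ
  c : V → ℕ
  par_root : par root = root
  dep_root : dep root = 0
  dep_par : ∀ v, v ≠ root → dep v = dep (par v) + 1
  cap_pos : ∀ v, v ≠ root → 1 ≤ c v
  root_degree : {w : V | par w = root ∧ w ≠ root}.ncard = 1
  internal_degree : ∀ v, v ≠ root → {w : V | par w = v ∧ w ≠ root}.Nonempty →
    {w : V | par w = v ∧ w ≠ root}.ncard = 2

namespace RTI

variable {V : Type*} (R : RTI V)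

/-- `R.below u v`: `v` lies in the subtree rooted at `u` (i.e. `u` is an ancestor of
`v`, allowing `u = v`). -/
def below (u v : V) : Prop :=
  Relation.ReflTransGen (fun a b => R.par b = a ∧ b ≠ R.root) u v

/-- `v` is a leaf of the tree other than the root. -/
def leaf (v : V) : Prop := v ≠ R.root ∧ ∀ w, w ≠ R.root → R.par w ≠ v

/-- The children of `v` (as lower endpoints of child-edges). -/
def children (v : V) : Set V := {w | R.par w = v ∧ w ≠ R.root}

/-- For an edge `e = (par v, v)`, the vertex set `V_e` of the instance `I(e)`. -/
def Ve (v : V) : Set V := insert (R.par v) {w | R.below v w}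

/-- `T_e`: the terminals of `I(e)` other than `u = par v`. -/
def Te (v : V) : Set V := {w | R.below v w ∧ R.leaf w}

/-- The full terminal set `T_e ∪ {u}` of the instance `I(e)`. -/
def S (v : V) : Set V := insert (R.par v) (R.Te v)

/-- The edge `(par x, x)` lies on the tree path between `t` and `t'`
(exactly one of `t, t'` is in the subtree below `x`). -/
def onPath (x t t' : V) : Prop :=
  (R.below x t ∧ ¬ R.below x t') ∨ (¬ R.below x t ∧ R.below x t')

/-- The vertex `x` lies on the tree path between `t` and `t'`. -/
def onPathV (x t t' : V) : Prop :=
  (R.below x t ∨ R.below x t') ∧ ∀ z, R.below z t → R.below z t' → R.below z x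

/-- Unordered pairs of distinct terminals of the instance `I(e)` for `e = (par v, v)`. -/
def PathPairs (v : V) : Set (Sym2 V) :=
  {p | ∃ t t', t ∈ R.S v ∧ t' ∈ R.S v ∧ t ≠ t' ∧ p = s(t, t')}

/-- `g` is a decomposition of `f` in the instance `I(e)`, `e = (par v, v)`:
`g` is supported on pairs of distinct terminals and, on every edge of `I(e)`,
`f` is the sum of `g` over the (unique) terminal-pair paths through that edge. -/
def IsDecomp (v : V) (f : V → ℕ) (g : Sym2 V → ℕ) : Prop :=
  (∀ p, g p ≠ 0 → p ∈ R.PathPairs v) ∧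
  ∀ w, R.below v w →
    f w = ∑ᶠ p ∈ {p : Sym2 V | ∃ t t', p = s(t, t') ∧ R.onPath w t t'}, g p

/-- `f` is an (integral) flow in the instance `I(e)`, `e = (par v, v)`. -/
def IsFlow (v : V) (f : V → ℕ) : Prop := ∃ g, R.IsDecomp v f g

/-- `f` is feasible in `I(e)`. -/
def Feasible (v : V) (f : V → ℕ) : Prop := ∀ w, R.below v w → f w ≤ R.c w

/-- `V_f(s)`: the set of vertices `w` of `I(e)` reachable from `s` by travelling
upward along edges with `c − f ≥ 1` to a common ancestor and then downward along
edges with `c − f ≥ 2`. -/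
def Vf (v : V) (f : V → ℕ) (s : V) : Set V :=
  {w | w ∈ R.Ve v ∧ ∃ z ∈ R.Ve v, R.below z s ∧ R.below z w ∧
    (∀ x, R.below z x → R.below x s → x ≠ z → f x + 1 ≤ R.c x) ∧
    (∀ x, R.below z x → R.below x w → x ≠ z → f x + 2 ≤ R.c x)}

/-- `W` induces a connected subgraph of the tree (it is closed under tree paths). -/
def ConnSet (W : Set V) : Prop :=
  ∀ w₁ ∈ W, ∀ w₂ ∈ W, ∀ x, R.onPathV x w₁ w₂ → x ∈ W

/-- `E(X)` inside the instance `I(e)`, `e = (par v, v)`: the edges `(par x, x)` of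
`I(e)` with exactly one endpoint in `X`. -/
def cutE (v : V) (X : Set V) : Set V :=
  {x | R.below v x ∧ ¬ (x ∈ X ↔ R.par x ∈ X)}

/-- `h(X) = Σ_{e' ∈ E(X)} h(e')` inside the instance `I(e)`, `e = (par v, v)`. -/
noncomputable def hval (v : V) (X : Set V) (h : V → ℕ) : ℕ := ∑ᶠ x ∈ R.cutE v X, h x

/-- `W` is a connected component of the subgraph of `I(e)` induced by `A`. -/
def IsComp (v : V) (A W : Set V) : Prop :=
  W.Nonempty ∧ W ⊆ A ∧ R.ConnSet W ∧
  (∀ x, R.below v x → x ∈ W → R.par x ∈ A → R.par x ∈ W) ∧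
  (∀ x, R.below v x → R.par x ∈ W → x ∈ A → x ∈ W)

/-- `odd(X)` (relative to the union `U` of the removed terminal sets): the components
`W` of `G_e − U` with `c(W)` odd whose parent-edge is a child-edge of `X`. -/
def oddOf (v : V) (U X : Set V) : Set (Set V) :=
  {W | R.IsComp v (R.Ve v \ U) W ∧ Odd (R.hval v W R.c) ∧
    ∃ y ∈ W, R.par y ∉ W ∧ R.par y ∈ X}

/-- The union of the sets `V_f(t)`, `t ∈ T_e`. -/
def UT (v : V) (f : V → ℕ) : Set V := ⋃ t ∈ R.Te v, R.Vf v f t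

/-- The union of the sets `V_f(t)`, `t ∈ T_e ∪ {u}`. -/
def USall (v : V) (f : V → ℕ) : Set V := ⋃ t ∈ R.S v, R.Vf v f t

/-- `f` is a blocking flow in `I(e)`, `e = (par v, v)`: a feasible flow such that
`{V_f(t) : t ∈ T_e}` is a cut-system of `T_e` (pairwise disjoint `t`-sets avoiding the
terminal `u = par v`) each member of which is blocked by `f`, i.e.
`f(e_t) = f(V_f(t)) = c(V_f(t)) − |odd(V_f(t))|`. -/
def IsBlocking (v : V) (f : V → ℕ) : Prop :=
  R.IsFlow v f ∧ R.Feasible v f ∧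
  (∀ t ∈ R.Te v, R.par v ∉ R.Vf v f t) ∧
  (∀ t ∈ R.Te v, ∀ t' ∈ R.Te v, t ≠ t' → R.Vf v f t ∩ R.Vf v f t' = ∅) ∧
  (∀ t ∈ R.Te v, f t = R.hval v (R.Vf v f t) f ∧
    R.hval v (R.Vf v f t) f + (R.oddOf v (R.UT v f) (R.Vf v f t)).ncard
      = R.hval v (R.Vf v f t) R.c)

/-- `Ψ(e)`: the set of values `f(e)` of blocking flows `f` of `I(e)`, `e = (par v, v)`. -/
def Psi (v : V) : Set ℕ := {x | ∃ f, R.IsBlocking v f ∧ f v = x}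

/-- `a(e)`: the least element of `Ψ(e)`. -/
noncomputable def aE (v : V) : ℕ := sInf (R.Psi v)

/-- `b(e)`: the greatest element of `Ψ(e)`. -/
noncomputable def bE (v : V) : ℕ := sSup (R.Psi v)

/-- The edge `(par x, x)` is dominating: `b(e') + 2 ≤ a(e)` for its sibling edge `e'`. -/
def Dominating (x : V) : Prop :=
  x ≠ R.root ∧ ∃ y, y ≠ R.root ∧ y ≠ x ∧ R.par y = R.par x ∧ R.bE y + 2 ≤ R.aE x

/-- The path from `v` down to `t` consists of dominating edges. -/
def DomPath (v t : V) : Prop :=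
  R.below v t ∧ ∀ x, R.below v x → R.below x t → x ≠ v → R.Dominating x

/-- Condition (a) for the edge `e = (par v, v)`. -/
def CondA (v : V) : Prop :=
  (∃ a b, R.Psi v = Iv a b) ∧
  (R.leaf v → R.Psi v = {R.c v}) ∧
  (∀ w₁ w₂, w₁ ≠ w₂ → R.children v = {w₁, w₂} →
    R.Psi v = (otimes (R.Psi w₁) (R.Psi w₂) ∩ Set.Iic (R.c v)) ∪ {R.c v})

/-- Condition (b) for the edge `e = (u,v)`: if `e` has a dominating child-edge
`e' = (v,w)`, then there is a terminal `t ∈ T_{e'}` with `g(u,t) ≥ a(e)` for every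
decomposition `g` of every blocking flow of `I(e)`, and `P_{v,t}` a dominating path. -/
def CondB (v : V) : Prop :=
  ∀ w ∈ R.children v, R.Dominating w →
    ∃ t ∈ R.Te w, R.DomPath v t ∧
      ∀ f g, R.IsBlocking v f → R.IsDecomp v f g → R.aE v ≤ g s(R.par v, t)

/-- `γ(𝒳)` for the cut-system `𝒳 = {V_f(t) : t ∈ T_e ∪ {u}}`. -/
noncomputable def gammaX (v : V) (f : V → ℕ) : ℕ :=
  ∑ᶠ t ∈ R.S v, R.hval v (R.Vf v f t) R.c

/-- `κ(𝒳)` for the cut-system `𝒳 = {V_f(t) : t ∈ T_e ∪ {u}}`: the number of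
components of `G_e − ∪𝒳` of odd capacity. -/
noncomputable def kappaX (v : V) (f : V → ℕ) : ℕ :=
  {W : Set V | R.IsComp v (R.Ve v \ R.USall v f) W ∧ Odd (R.hval v W R.c)}.ncard

end RTI

namespace RTI

variable {V : Type*} {R : RTI V} {v w x y z a b s t : V}

/-! ### The ancestor order -/

theorem below_refl (x : V) : R.below x x := Relation.ReflTransGen.refl

theorem below.trans (h : R.below x y) (h' : R.below y z) : R.below x z :=
  Relation.ReflTransGen.trans h h'

theorem below_par_self (hy : y ≠ R.root) : R.below (R.par y) y :=
  Relation.ReflTransGen.single ⟨rfl, hy⟩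

theorem below_of_below_par (hy : y ≠ R.root) (h : R.below x (R.par y)) : R.below x y :=
  h.trans (below_par_self hy)

theorem below.dep_le (h : R.below x y) : R.dep x ≤ R.dep y := by
  induction h with
  | refl => exact le_rfl
  | tail _ h ih =>
    have := R.dep_par _ h.2
    rw [h.1] at this
    omega

theorem below.eq_or (h : R.below x y) : y = x ∨ (y ≠ R.root ∧ R.below x (R.par y)) := by
  rcases Relation.ReflTransGen.cases_tail h with h | ⟨c, hc, hcy, hy⟩
  · exact Or.inl h
  · exact Or.inr ⟨hy, by rw [hcy]; exact hc⟩

theorem below.par_of_ne (h : R.below x y) (hne : y ≠ x) : R.below x (R.par y) :=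
  (h.eq_or.resolve_left hne).2

theorem not_below_par (hy : y ≠ R.root) : ¬ R.below y (R.par y) := fun h => by
  have := h.dep_le
  have := R.dep_par y hy
  omega

theorem below.antisymm (h : R.below x y) (h' : R.below y x) : x = y := by
  rcases h.eq_or with h1 | ⟨hy, h1⟩
  · exact h1.symm
  · exact absurd (h'.trans h1) (not_below_par hy)

theorem below.total (h : R.below a x) (h' : R.below b x) : R.below a b ∨ R.below b a := by
  induction h with
  | refl => exact Or.inr h'
  | tail hac hc ih =>
    rcases h'.eq_or with h1 | ⟨_, h1⟩
    · subst h1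
      exact Or.inl (hac.tail hc)
    · rw [hc.1] at h1
      exact ih h1

theorem below.ne_root (h : R.below v x) (hv : v ≠ R.root) : x ≠ R.root := by
  rintro rfl
  have h1 := h.dep_le
  have := R.dep_par v hv
  rw [R.dep_root] at h1
  omega

/-- An ancestor of a descendant of `w` that lies strictly below `par w` lies below `w`. -/
theorem below.of_par (hw : R.below w s) (h : R.below (R.par w) x) (hx : R.below x s)
    (hne : x ≠ R.par w) : R.below w x := by
  rcases hw.total hx with h1 | h1
  · exact h1
  · rcases h1.eq_or with h2 | ⟨_, h2⟩
    · subst h2; exact below_refl _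
    · exact absurd (h2.antisymm h) hne

theorem leaf.eq_of_below (ht : R.leaf t) (h : R.below t x) : x = t := by
  rcases Relation.ReflTransGen.cases_head h with h | ⟨c, ⟨h1, h2⟩, _⟩
  · exact h.symm
  · exact absurd h1 (ht.2 c h2)

theorem exists_child_below (h : R.below x t) (hne : x ≠ t) :
    ∃ z ∈ R.children x, R.below z t := by
  rcases Relation.ReflTransGen.cases_head h with h | ⟨c, h1, h2⟩
  · exact absurd h hne
  · exact ⟨c, h1, h2⟩

theorem leaf.notMem_children (ht : R.leaf t) : x ∉ R.children t :=
  fun h => ht.2 x h.2 h.1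

theorem exists_children_eq_pair (hx : x ≠ R.root) (ha : a ∈ R.children x) :
    ∃ b, a ≠ b ∧ R.children x = {a, b} := by
  have h2 := R.internal_degree x hx ⟨a, ha⟩
  obtain ⟨p, q, hpq, h⟩ := Set.ncard_eq_two.1 h2
  have h' : R.children x = {p, q} := h
  rw [h'] at ha ⊢
  rcases ha with rfl | rfl
  · exact ⟨q, hpq, rfl⟩
  · exact ⟨p, hpq.symm, Set.pair_comm _ _⟩

theorem children_eq_pair (hx : x ≠ R.root) (ha : a ∈ R.children x) (hb : b ∈ R.children x)
    (hab : a ≠ b) : R.children x = {a, b} := by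
  obtain ⟨c, _, h⟩ := exists_children_eq_pair hx ha
  rw [h] at hb ⊢
  rcases hb with rfl | rfl
  · exact absurd rfl hab
  · rfl

theorem exists_children_of_not_leaf (hx : x ≠ R.root) (h : ¬ R.leaf x) :
    ∃ a b, a ≠ b ∧ R.children x = {a, b} := by
  simp only [leaf, not_and, not_forall, not_not] at h
  obtain ⟨a, ha, hax⟩ := h hx
  exact ⟨a, exists_children_eq_pair hx ⟨hax, ha⟩⟩

theorem not_below_of_sibling (hb : b ≠ R.root) (hab : a ≠ b) (hp : R.par a = R.par b)
    (ha : a ≠ R.root) (h1 : R.below a x) : ¬ R.below b x := by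
  intro h2
  rcases h1.total h2 with h | h
  · have := h.par_of_ne hab.symm
    rw [← hp] at this
    exact not_below_par ha this
  · have := h.par_of_ne hab
    rw [hp] at this
    exact not_below_par hb this

theorem exists_lca (ha : R.below x a) (hb : R.below x b) :
    ∃ z, R.below x z ∧ R.below z a ∧ R.below z b ∧
      ∀ y, R.below y a → R.below y b → R.below y z := by
  induction ha with
  | refl => exact ⟨x, below_refl _, below_refl _, hb, fun y h _ => h⟩
  | @tail c d hc hd ih =>
    by_cases h : R.below d b
    · exact ⟨d, hc.tail hd, below_refl _, h, fun y h _ => h⟩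
    · obtain ⟨z, h1, h2, h3, h4⟩ := ih
      refine ⟨z, h1, h2.tail hd, h3, fun y hy hyb => h4 y ?_ hyb⟩
      rcases hy.eq_or with h5 | ⟨_, h5⟩
      · exact absurd (h5 ▸ hyb) h
      · rwa [hd.1] at h5

/-- Walking down from `z` to `a`, some edge separates `X` from its complement if the ends do. -/
theorem below.exists_cut {X : Set V} (h : R.below z a) (hX : ¬ (z ∈ X ↔ a ∈ X)) :
    ∃ y, R.below z y ∧ y ≠ z ∧ R.below y a ∧ ¬ (y ∈ X ↔ R.par y ∈ X) := by
  induction h with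
  | refl => exact absurd Iff.rfl hX
  | @tail c d hc hd ih =>
    by_cases h : d ∈ X ↔ c ∈ X
    · obtain ⟨y, h1, h2, h3, h4⟩ := ih (by rwa [← h])
      exact ⟨y, h1, h2, h3.tail hd, h4⟩
    · refine ⟨d, hc.tail hd, ?_, below_refl _, by rwa [hd.1]⟩
      rintro rfl
      have hcd : R.below d (R.par d) := by rw [hd.1]; exact hc
      exact not_below_par hd.2 hcd

/-! ### The instances `I(e)` -/

theorem par_notMem_below (hv : v ≠ R.root) (h : R.below v x) : x ≠ R.par v := by
  rintro rfl
  exact not_below_par hv h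

theorem below.par_mem_Ve (h : R.below v w) : R.par w ∈ R.Ve v := by
  rcases h.eq_or with rfl | ⟨_, h⟩
  · exact Or.inl rfl
  · exact Or.inr h

theorem mem_S_below (hv : v ≠ R.root) (h : a ∈ R.S v) : R.below (R.par v) a := by
  rcases h with rfl | h
  · exact below_refl _
  · exact (below_par_self hv).trans h.1

theorem mem_Ve_of_mem_Te (h : t ∈ R.Te v) : t ∈ R.Ve v := Or.inr h.1

theorem Te_mono (h : R.below v w) : R.Te w ⊆ R.Te v := fun _ ht => ⟨h.trans ht.1, ht.2⟩

theorem mem_Te_of_mem_S (hv : v ≠ R.root) (ha : a ∈ R.S v) (hvw : R.below v w)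
    (h : R.below w a) : a ∈ R.Te w := by
  rcases ha with rfl | ha
  · exact absurd rfl (par_notMem_below hv (hvw.trans h))
  · exact ⟨h, ha.2⟩

theorem mem_Te_child (hch : R.children v = {a, b}) (ht : t ∈ R.Te v) :
    t ∈ R.Te a ∨ t ∈ R.Te b := by
  have hne : v ≠ t := by
    rintro rfl
    exact ht.2.notMem_children (x := a) (by rw [hch]; exact Or.inl rfl)
  obtain ⟨z, hz, hzt⟩ := exists_child_below ht.1 hne
  rw [hch] at hz
  rcases hz with rfl | rfl
  · exact Or.inl ⟨hzt, ht.2⟩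
  · exact Or.inr ⟨hzt, ht.2⟩

theorem self_mem_Vf {f : V → ℕ} (hs : s ∈ R.Ve v) : s ∈ R.Vf v f s :=
  ⟨hs, s, hs, below_refl _, below_refl _, fun _ h h' hne => absurd (h'.antisymm h) hne,
    fun _ h h' hne => absurd (h'.antisymm h) hne⟩

theorem par_mem_Vf_iff {f : V → ℕ} (hw : w ≠ R.root) (hvw : R.below v w) (hs : R.below w s) :
    R.par w ∈ R.Vf v f s ↔ ∀ x, R.below w x → R.below x s → f x + 1 ≤ R.c x := by
  constructor
  · rintro ⟨_, z, _, _, hzw, h1, _⟩ x hx hxs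
    refine h1 x (hzw.trans ((below_par_self hw).trans hx)) hxs ?_
    rintro rfl
    exact not_below_par hw (hx.trans hzw)
  · intro h
    exact ⟨hvw.par_mem_Ve, R.par w, hvw.par_mem_Ve, (below_par_self hw).trans hs, below_refl _,
      fun x hx hxs hne => h x (hs.of_par hx hxs hne) hxs,
      fun x hx hx' hne => absurd (hx'.antisymm hx) hne⟩

theorem mem_Vf_of_between {f : V → ℕ} (h : y ∈ R.Vf v f t) (hyx : R.below y x)
    (hxt : R.below x t) (hx : x ∈ R.Ve v) : x ∈ R.Vf v f t := by
  obtain ⟨_, z, _, _, hzy, h1, _⟩ := h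
  refine ⟨hx, x, hx, hxt, below_refl _, fun a hxa hat hne => ?_,
    fun a h h' hne => absurd (h'.antisymm h) hne⟩
  refine h1 a (hzy.trans (hyx.trans hxa)) hat ?_
  rintro rfl
  exact hne (hxa.antisymm (hzy.trans hyx)).symm

/-- If the terminal set of `s` does not reach `par w`, then it stays below `w`. -/
theorem Vf_subset_below {f : V → ℕ} (hw : w ≠ R.root) (hvw : R.below v w) (hs : R.below w s)
    (H : R.par w ∉ R.Vf v f s) (hx : x ∈ R.Vf v f s) : R.below w x := by
  obtain ⟨_, z, _, hzs, hzx, h1, _⟩ := hx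
  rcases hs.total hzs with h | h
  · exact h.trans hzx
  · rcases h.eq_or with rfl | ⟨_, h⟩
    · exact hzx
    · refine absurd ((par_mem_Vf_iff hw hvw hs).2 fun x hx hxs => ?_) H
      refine h1 x (h.trans ((below_par_self hw).trans hx)) hxs ?_
      rintro rfl
      exact not_below_par hw (hx.trans h)

theorem Vf_eq {f : V → ℕ} (hv : v ≠ R.root) (hvw : R.below v w) (hne : w ≠ v)
    (hs : R.below w s) (H : R.par w ∉ R.Vf v f s) : R.Vf w f s = R.Vf v f s := by
  have hw := hvw.ne_root hv
  have hsub : R.Ve w ⊆ R.Ve v := by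
    rintro x (rfl | hx)
    · exact Or.inr (hvw.par_of_ne hne)
    · exact Or.inr (hvw.trans hx)
  ext x
  constructor
  · rintro ⟨hx, z, hz, h⟩
    exact ⟨hsub hx, z, hsub hz, h⟩
  · intro hx
    have hwx := Vf_subset_below hw hvw hs H hx
    obtain ⟨_, z, hz, hzs, hzx, h1, h2⟩ := hx
    refine ⟨Or.inr hwx, z, Or.inr ?_, hzs, hzx, h1, h2⟩
    refine Vf_subset_below hw hvw hs H ⟨hz, z, hz, hzs, below_refl _, h1, ?_⟩
    exact fun x h h' hne => absurd (h'.antisymm h) hne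

theorem cutE_eq {X : Set V} (hv : v ≠ R.root) (hvw : R.below v w)
    (hX : ∀ x ∈ X, R.below w x) : R.cutE w X = R.cutE v X := by
  ext x
  constructor
  · exact fun h => ⟨hvw.trans h.1, h.2⟩
  · refine fun h => ⟨?_, h.2⟩
    by_cases hx : x ∈ X
    · exact hX x hx
    · have : R.par x ∈ X := by
        have := h.2
        tauto
      exact below_of_below_par (h.1.ne_root hv) (hX _ this)

theorem hval_eq {X : Set V} (hv : v ≠ R.root) (hvw : R.below v w)
    (hX : ∀ x ∈ X, R.below w x) (h : V → ℕ) : R.hval w X h = R.hval v X h := by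
  rw [hval, hval, cutE_eq hv hvw hX]

theorem ConnSet.subset_below {W : Set V} (hW : R.ConnSet W) (hy : y ∈ W) (hyr : y ≠ R.root)
    (hp : R.par y ∉ W) (hx : x ∈ W) : R.below y x := by
  by_contra h
  refine hp (hW x hx y hy _ ⟨Or.inr (below_par_self hyr), fun z hzx hzy => ?_⟩)
  rcases hzy.eq_or with rfl | ⟨_, h1⟩
  · exact absurd hzx h
  · exact h1

theorem IsComp.transfer {A A' W : Set V} (hw : w ≠ R.root) (hvy : R.below v y)
    (hwy : R.below w y) (hA : R.par y ∉ A') (hAA : ∀ x, R.below y x → (x ∈ A ↔ x ∈ A'))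
    (hW : ∀ x ∈ W, R.below y x) (h : R.IsComp v A W) : R.IsComp w A' W := by
  obtain ⟨h1, h2, h3, h4, h5⟩ := h
  refine ⟨h1, fun x hx => (hAA x (hW x hx)).1 (h2 hx), h3, fun x _ hx hp => ?_,
    fun x hwx hp hx => ?_⟩
  · have hne : x ≠ y := by
      rintro rfl
      exact hA hp
    exact h4 x (hvy.trans (hW x hx)) hx ((hAA _ ((hW x hx).par_of_ne hne)).2 hp)
  · have hyx := below_of_below_par (hwx.ne_root hw) (hW _ hp)
    exact h5 x (hvy.trans hyx) hp ((hAA x hyx).2 hx)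

theorem mem_diff_UT_iff {f : V → ℕ} (hv : v ≠ R.root) (hvw : R.below v w) (hne : w ≠ v)
    (H : ∀ s ∈ R.Te w, R.par w ∉ R.Vf v f s)
    (D : ∀ s ∈ R.Te v, ∀ s' ∈ R.Te v, s ≠ s' → R.Vf v f s ∩ R.Vf v f s' = ∅)
    (hs : s ∈ R.Te w) (hyr : y ≠ R.root) (hy : R.par y ∈ R.Vf v f s) (hyx : R.below y x) :
    x ∈ R.Ve w \ R.UT w f ↔ x ∈ R.Ve v \ R.UT v f := by
  have hw := hvw.ne_root hv
  have hwp := Vf_subset_below hw hvw hs.1 (H s hs) hy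
  have hwx : R.below w x := hwp.trans ((below_par_self hyr).trans hyx)
  have hx1 : x ∈ R.Ve w := Or.inr hwx
  have hx2 : x ∈ R.Ve v := Or.inr (hvw.trans hwx)
  have key : x ∈ R.UT w f ↔ x ∈ R.UT v f := by
    simp only [UT, Set.mem_iUnion, exists_prop]
    constructor
    · rintro ⟨t, ht, hx⟩
      rw [Vf_eq hv hvw hne ht.1 (H t ht)] at hx
      exact ⟨t, Te_mono hvw ht, hx⟩
    · rintro ⟨t, ht, hx⟩
      by_cases htw : R.below w t
      · have ht' : t ∈ R.Te w := ⟨htw, ht.2⟩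
        refine ⟨t, ht', ?_⟩
        rwa [Vf_eq hv hvw hne htw (H t ht')]
      · exfalso
        obtain ⟨_, z, hz, hzt, hzx, h1, h2⟩ := hx
        have hzw : R.below z w := by
          rcases hzx.total hwx with h | h
          · exact h
          · exact absurd (h.trans hzt) htw
        have hpt : R.par y ∈ R.Vf v f t :=
          ⟨Or.inr (hvw.trans hwp), z, hz, hzt, hzw.trans hwp, h1, fun a ha hay hane =>
            h2 a ha (hay.trans ((below_par_self hyr).trans hyx)) hane⟩
        have hst : s ≠ t := by
          rintro rfl
          exact htw hs.1
        have := D s (Te_mono hvw hs) t ht hst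
        exact Set.eq_empty_iff_forall_notMem.1 this _ ⟨hy, hpt⟩
  simp only [Set.mem_sdiff, hx1, hx2, key]

theorem oddOf_eq {f : V → ℕ} (hv : v ≠ R.root) (hvw : R.below v w) (hne : w ≠ v)
    (H : ∀ s ∈ R.Te w, R.par w ∉ R.Vf v f s)
    (D : ∀ s ∈ R.Te v, ∀ s' ∈ R.Te v, s ≠ s' → R.Vf v f s ∩ R.Vf v f s' = ∅)
    (hs : s ∈ R.Te w) :
    R.oddOf w (R.UT w f) (R.Vf w f s) = R.oddOf v (R.UT v f) (R.Vf v f s) := by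
  have hw := hvw.ne_root hv
  have hVs := Vf_eq hv hvw hne hs.1 (H s hs)
  have aux : ∀ {W : Set V}, R.ConnSet W → ∀ {y}, y ∈ W → R.par y ∉ W →
      R.par y ∈ R.Vf v f s → y ≠ R.root ∧ R.below w y ∧ ∀ x ∈ W, R.below y x := by
    intro W hW y hy hp hX
    have hyr : y ≠ R.root := by
      rintro rfl
      exact hp (by rwa [R.par_root])
    exact ⟨hyr, below_of_below_par hyr (Vf_subset_below hw hvw hs.1 (H s hs) hX),
      fun x hx => hW.subset_below hy hyr hp hx⟩
  ext W
  constructor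
  · rintro ⟨hW, hodd, y, hy, hp, hX⟩
    rw [hVs] at hX
    obtain ⟨hyr, hwy, hsub⟩ := aux hW.2.2.1 hy hp hX
    have hm : R.par y ∈ R.UT v f := Set.mem_biUnion (Te_mono hvw hs) hX
    refine ⟨hW.transfer hv hwy (hvw.trans hwy) (fun h => h.2 hm)
      (fun x hx => mem_diff_UT_iff hv hvw hne H D hs hyr hX hx) hsub, ?_, y, hy, hp, hX⟩
    rwa [← hval_eq hv hvw fun x hx => hwy.trans (hsub x hx)]
  · rintro ⟨hW, hodd, y, hy, hp, hX⟩
    obtain ⟨hyr, hwy, hsub⟩ := aux hW.2.2.1 hy hp hX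
    have hm : R.par y ∈ R.UT w f := Set.mem_biUnion hs (by rwa [hVs])
    refine ⟨hW.transfer hw (hvw.trans hwy) hwy (fun h => h.2 hm)
      (fun x hx => (mem_diff_UT_iff hv hvw hne H D hs hyr hX hx).symm) hsub, ?_, y, hy, hp,
      by rwa [hVs]⟩
    rwa [hval_eq hv hvw fun x hx => hwy.trans (hsub x hx)]

/-! ### Flows and their decompositions -/

/-- The path of the pair `p` uses the edge `(par x, x)`. -/
def Crosses (R : RTI V) (x : V) (p : Sym2 V) : Prop := ∃ t t', p = s(t, t') ∧ R.onPath x t t'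

theorem crosses_mk : R.Crosses x s(a, b) ↔ ¬ (R.below x a ↔ R.below x b) := by
  constructor
  · rintro ⟨t, t', h, h'⟩
    rcases Sym2.eq_iff.1 h with ⟨rfl, rfl⟩ | ⟨rfl, rfl⟩ <;> unfold onPath at h' <;> tauto
  · intro h
    refine ⟨a, b, rfl, ?_⟩
    unfold onPath
    tauto

theorem isDecomp_iff [Fintype V] {f : V → ℕ} {g : Sym2 V → ℕ} :
    R.IsDecomp v f g ↔ (∀ p, g p ≠ 0 → p ∈ R.PathPairs v) ∧
      ∀ w, R.below v w → f w = ∑ p, if R.Crosses w p then g p else 0 := by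
  have key : ∀ w, ∑ᶠ p ∈ {p : Sym2 V | ∃ t t', p = s(t, t') ∧ R.onPath w t t'}, g p
      = ∑ p, if R.Crosses w p then g p else 0 := fun w => by
    rw [finsum_mem_def, finsum_eq_sum_of_fintype]
    refine Finset.sum_congr rfl fun p _ => ?_
    rw [Set.indicator_apply]
    exact if_congr Iff.rfl rfl rfl
  simp only [IsDecomp, key]

theorem isFlow_of_family [Fintype V] {ι : Type*} [Fintype ι] {f : V → ℕ} (n : ι → ℕ)
    (p : ι → Sym2 V) (hp : ∀ i, n i ≠ 0 → p i ∈ R.PathPairs v)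
    (hf : ∀ w, R.below v w → f w = ∑ i, if R.Crosses w (p i) then n i else 0) :
    R.IsFlow v f := by
  refine ⟨fun q => ∑ i, if p i = q then n i else 0, isDecomp_iff.2 ⟨fun q hq => ?_, ?_⟩⟩
  · obtain ⟨i, _, hi⟩ := Finset.exists_ne_zero_of_sum_ne_zero hq
    rw [ne_eq, ite_eq_right_iff, Classical.not_imp] at hi
    exact hi.1 ▸ hp i hi.2
  · intro w hw
    rw [hf w hw]
    have : ∀ q, (if R.Crosses w q then ∑ i, (if p i = q then n i else 0) else 0)
        = ∑ i, if p i = q then (if R.Crosses w (p i) then n i else 0) else 0 := fun q => by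
      split_ifs with h
      · refine Finset.sum_congr rfl fun i _ => ?_
        split_ifs <;> simp_all
      · refine (Finset.sum_eq_zero fun i _ => ?_).symm
        split_ifs <;> simp_all
    rw [Finset.sum_congr rfl fun q _ => this q, Finset.sum_comm]
    simp

theorem le_of_crosses [Fintype V] {f : V → ℕ} {g : Sym2 V → ℕ} (hg : R.IsDecomp v f g)
    (hw : R.below v w) {p : Sym2 V} (hp : R.Crosses w p) : g p ≤ f w := by
  rw [(isDecomp_iff.1 hg).2 w hw]
  refine le_trans ?_ (Finset.single_le_sum (fun _ _ => Nat.zero_le _) (Finset.mem_univ p))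
  rw [if_pos hp]

theorem crosses_par (hv : v ≠ R.root) (h : R.below v w) (ht : R.below w t) :
    R.Crosses w s(R.par v, t) :=
  crosses_mk.2 fun h' => not_below_par hv (h.trans (h'.2 ht))

theorem eq_of_crosses_imp_mem [Fintype V] {f : V → ℕ} {g : Sym2 V → ℕ} (hv : v ≠ R.root)
    (hg : R.IsDecomp v f g) (ht : t ∈ R.Te v)
    (h : ∀ p, g p ≠ 0 → R.Crosses v p → t ∈ p) : f v = g s(R.par v, t) := by
  have hg' := isDecomp_iff.1 hg
  rw [hg'.2 v (below_refl _), Finset.sum_eq_single s(R.par v, t), if_pos]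
  · exact crosses_par hv (below_refl _) ht.1
  · intro p _ hp
    by_contra hc
    rw [ite_eq_right_iff, Classical.not_imp] at hc
    have htp := h p hc.2 hc.1
    obtain ⟨a, b, ha, hb, -, rfl⟩ := hg'.1 p hc.2
    have hcr := crosses_mk.1 hc.1
    have hS : ∀ {x}, x ∈ R.S v → ¬ R.below v x → x = R.par v := fun hx hx' =>
      hx.resolve_right fun h => hx' h.1
    rcases Sym2.mem_iff.1 htp with rfl | rfl
    · have := hS hb fun h => hcr (iff_of_true ht.1 h)
      exact hp (by rw [this, Sym2.eq_swap])
    · have := hS ha fun h => hcr (iff_of_true h ht.1)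
      exact hp (by rw [this])
  · simp

theorem leaf.eq_decomp [Fintype V] {f : V → ℕ} {g : Sym2 V → ℕ} (hv : R.leaf v)
    (hg : R.IsDecomp v f g) : f v = g s(R.par v, v) := by
  refine eq_of_crosses_imp_mem hv.1 hg ⟨below_refl _, hv⟩ fun p hp hc => ?_
  obtain ⟨a, b, -, -, -, rfl⟩ := hg.1 p hp
  have hcr := crosses_mk.1 hc
  rw [Sym2.mem_iff]
  by_contra h
  rw [not_or] at h
  refine hcr (iff_of_false ?_ ?_)
  · exact fun h' => h.1 (hv.eq_of_below h').symm
  · exact fun h' => h.2 (hv.eq_of_below h').symm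

/-- The contraction of everything outside the subtree below `w` to the parent of `w`. -/
noncomputable def contract (R : RTI V) (w a : V) : V := if R.below w a then a else R.par w

theorem below_contract (hw : w ≠ R.root) (hx : R.below w x) :
    R.below x (R.contract w a) ↔ R.below x a := by
  unfold contract
  split_ifs with h
  · rfl
  · exact iff_of_false (fun hc => not_below_par hw (hx.trans hc)) fun hc => h (hx.trans hc)

/-- The decomposition of the restriction to `I(e)`, `e = (par w, w)`, induced by `g`. -/
noncomputable def restrictDecomp [Fintype V] (R : RTI V) (w : V) (g : Sym2 V → ℕ)
    (q : Sym2 V) : ℕ :=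
  ∑ p : Sym2 V, if p.map (R.contract w) = q ∧ ¬ q.IsDiag then g p else 0

theorem crosses_map_contract (hw : w ≠ R.root) (hx : R.below w x) (p : Sym2 V) :
    R.Crosses x (p.map (R.contract w)) ↔ R.Crosses x p := by
  induction p with
  | h a b => rw [Sym2.map_mk, crosses_mk, crosses_mk, below_contract hw hx, below_contract hw hx]

theorem Crosses.not_isDiag {p : Sym2 V} (h : R.Crosses x p) : ¬ p.IsDiag := by
  induction p with
  | h a b =>
    rw [Sym2.mk_isDiag_iff]
    rintro rfl
    exact crosses_mk.1 h Iff.rfl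

theorem isDecomp_restrict [Fintype V] {f : V → ℕ} {g : Sym2 V → ℕ} (hv : v ≠ R.root)
    (hvw : R.below v w) (hg : R.IsDecomp v f g) : R.IsDecomp w f (R.restrictDecomp w g) := by
  have hg' := isDecomp_iff.1 hg
  refine isDecomp_iff.2 ⟨fun q hq => ?_, fun x hx => ?_⟩
  · obtain ⟨p, _, hp⟩ := Finset.exists_ne_zero_of_sum_ne_zero hq
    rw [ne_eq, ite_eq_right_iff, Classical.not_imp] at hp
    obtain ⟨⟨h1, h2⟩, h3⟩ := hp
    obtain ⟨a, b, ha, hb, -, rfl⟩ := hg'.1 p h3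
    have hS : ∀ {x}, x ∈ R.S v → R.contract w x ∈ R.S w := by
      intro x hx
      unfold contract
      split_ifs with h
      · exact Or.inr (mem_Te_of_mem_S hv hx hvw h)
      · exact Or.inl rfl
    rw [Sym2.map_mk] at h1
    refine ⟨_, _, hS ha, hS hb, ?_, h1.symm⟩
    rwa [← h1, Sym2.mk_isDiag_iff] at h2
  · have hw := hvw.ne_root hv
    rw [hg'.2 x (hvw.trans hx)]
    have : ∀ q, (if R.Crosses x q then R.restrictDecomp w g q else 0)
        = ∑ p : Sym2 V, if p.map (R.contract w) = q then
            (if R.Crosses x p then g p else 0) else 0 := fun q => by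
      unfold restrictDecomp
      split_ifs with h
      · refine Finset.sum_congr rfl fun p _ => ?_
        by_cases hpq : p.map (R.contract w) = q
        · rw [if_pos ⟨hpq, h.not_isDiag⟩, if_pos hpq, if_pos]
          rwa [← crosses_map_contract hw hx, hpq]
        · rw [if_neg hpq, if_neg fun h => hpq h.1]
      · refine (Finset.sum_eq_zero fun p _ => ?_).symm
        by_cases hpq : p.map (R.contract w) = q
        · rw [if_pos hpq, if_neg]
          rwa [← crosses_map_contract hw hx, hpq]
        · rw [if_neg hpq]
    rw [Finset.sum_congr rfl fun q _ => this q, Finset.sum_comm]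
    simp

theorem restrictDecomp_le [Fintype V] {f : V → ℕ} {g : Sym2 V → ℕ}
    (hab : a ≠ b) (hch : R.children v = {a, b}) (hg : R.IsDecomp v f g) (ht : t ∈ R.Te a) :
    R.restrictDecomp a g s(v, t) ≤ g s(R.par v, t) + f b := by
  have hg' := isDecomp_iff.1 hg
  have ha : a ∈ R.children v := by rw [hch]; exact Or.inl rfl
  have hb : b ∈ R.children v := by rw [hch]; exact Or.inr rfl
  have hva : ¬ R.below a v := by
    have := not_below_par ha.2
    rwa [ha.1] at this
  have hvb : R.below v b := by
    have := below_par_self hb.2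
    rwa [hb.1] at this
  have hbt : ¬ R.below b t :=
    not_below_of_sibling hb.2 hab (ha.1.trans hb.1.symm) ha.2 ht.1
  have h1 : g s(R.par v, t) = ∑ p : Sym2 V, if p = s(R.par v, t) then g p else 0 := by simp
  rw [h1, hg'.2 b hvb, ← Finset.sum_add_distrib]
  refine Finset.sum_le_sum fun p _ => ?_
  split_ifs with h h2 h3 h3 <;> try omega
  by_contra hgp
  obtain ⟨c, d, hc, hd, -, rfl⟩ := hg'.1 p (by omega)
  have key : ∀ {c d}, c ∈ R.S v → R.contract a c = v → R.contract a d = t →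
      s(c, d) = s(R.par v, t) ∨ R.Crosses b s(c, d) := by
    intro c d hc h4 h5
    have hdt : d = t := by
      unfold contract at h5
      split_ifs at h5 with h6
      · exact h5
      · rw [ha.1] at h5
        exact absurd (h5 ▸ ht.1) hva
    subst hdt
    have hac : ¬ R.below a c := by
      intro h6
      rw [contract, if_pos h6] at h4
      exact hva (h4 ▸ h6)
    rcases hc with rfl | hc
    · exact Or.inl rfl
    · refine Or.inr (crosses_mk.2 fun h => hbt (h.1 ?_))
      exact ((mem_Te_child hch hc).resolve_left fun h => hac h.1).1
  have h4 := h.1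
  rw [Sym2.map_mk] at h4
  rcases Sym2.eq_iff.1 h4 with ⟨h5, h6⟩ | ⟨h5, h6⟩
  · exact (key hc h5 h6).elim h2 h3
  · rw [Sym2.eq_swap] at h2 h3
    exact (key hd h6 h5).elim h2 h3

/-! ### Blocking flows -/

theorem IsBlocking.restrict [Fintype V] {f : V → ℕ} (hf : R.IsBlocking v f) (hv : v ≠ R.root)
    (hvw : R.below v w) (hne : w ≠ v) (H : ∀ s ∈ R.Te w, R.par w ∉ R.Vf v f s) :
    R.IsBlocking w f := by
  obtain ⟨⟨g, hg⟩, h2, h3, D, h5⟩ := hf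
  have hVs : ∀ s ∈ R.Te w, R.Vf w f s = R.Vf v f s := fun s hs =>
    Vf_eq hv hvw hne hs.1 (H s hs)
  have hsub : ∀ s ∈ R.Te w, ∀ x ∈ R.Vf v f s, R.below w x := fun s hs x hx =>
    Vf_subset_below (hvw.ne_root hv) hvw hs.1 (H s hs) hx
  refine ⟨⟨_, isDecomp_restrict hv hvw hg⟩, fun x hx => h2 x (hvw.trans hx), fun s hs => ?_,
    fun s hs s' hs' hss => ?_, fun s hs => ?_⟩
  · rw [hVs s hs]; exact H s hs
  · rw [hVs s hs, hVs s' hs']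
    exact D s (Te_mono hvw hs) s' (Te_mono hvw hs') hss
  · rw [oddOf_eq hv hvw hne H D hs, hVs s hs, hval_eq hv hvw (hsub s hs),
      hval_eq hv hvw (hsub s hs)]
    exact h5 s (Te_mono hvw hs)

theorem isBlocking_of_children {f : V → ℕ} (hv : v ≠ R.root)
    (hch : R.children v = {a, b}) (hab : a ≠ b) (hf : R.IsFlow v f) (hc : f v ≤ R.c v)
    (ha : R.IsBlocking a f) (hb : R.IsBlocking b f) : R.IsBlocking v f := by
  have hmem : ∀ {w}, w ∈ R.children v → R.below v w ∧ w ≠ v := by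
    intro w hw
    have h1 := below_par_self hw.2
    rw [hw.1] at h1
    refine ⟨h1, ?_⟩
    rintro rfl
    exact not_below_par hw.2 (by rw [hw.1]; exact h1)
  have hach : a ∈ R.children v := by rw [hch]; exact Or.inl rfl
  have hbch : b ∈ R.children v := by rw [hch]; exact Or.inr rfl
  have H : ∀ {w}, w ∈ R.children v → R.IsBlocking w f →
      ∀ s ∈ R.Te w, R.par w ∉ R.Vf v f s := by
    intro w hw hwf s hs h
    refine hwf.2.2.1 s hs ((par_mem_Vf_iff hw.2 (below_refl _) hs.1).2 ?_)
    exact (par_mem_Vf_iff hw.2 (hmem hw).1 hs.1).1 h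
  have hVs : ∀ {w}, w ∈ R.children v → R.IsBlocking w f →
      ∀ s ∈ R.Te w, R.Vf w f s = R.Vf v f s := fun hw hwf s hs =>
    Vf_eq hv (hmem hw).1 (hmem hw).2 hs.1 (H hw hwf s hs)
  have hsub : ∀ {w}, w ∈ R.children v → R.IsBlocking w f →
      ∀ s ∈ R.Te w, ∀ x ∈ R.Vf v f s, R.below w x := fun hw hwf s hs x hx =>
    Vf_subset_below hw.2 (hmem hw).1 hs.1 (H hw hwf s hs) hx
  have hTe : ∀ s ∈ R.Te v, ∃ w ∈ R.children v, R.IsBlocking w f ∧ s ∈ R.Te w := fun s hs =>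
    (mem_Te_child hch hs).elim (fun h => ⟨a, hach, ha, h⟩) fun h => ⟨b, hbch, hb, h⟩
  have D : ∀ s ∈ R.Te v, ∀ s' ∈ R.Te v, s ≠ s' → R.Vf v f s ∩ R.Vf v f s' = ∅ := by
    intro s hs s' hs' hss
    obtain ⟨w, hw, hwf, hsw⟩ := hTe s hs
    obtain ⟨w', hw', hwf', hsw'⟩ := hTe s' hs'
    by_cases hww : w = w'
    · subst hww
      rw [← hVs hw hwf s hsw, ← hVs hw hwf s' hsw']
      exact hwf.2.2.2.1 s hsw s' hsw' hss
    · refine Set.eq_empty_iff_forall_notMem.2 fun x hx => ?_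
      exact not_below_of_sibling hw'.2 hww (hw.1.trans hw'.1.symm) hw.2
        (hsub hw hwf s hsw x hx.1) (hsub hw' hwf' s' hsw' x hx.2)
  refine ⟨hf, fun x hx => ?_, fun s hs h => ?_, D, fun s hs => ?_⟩
  · by_cases hxv : x = v
    · rwa [hxv]
    · obtain ⟨z, hz, hzx⟩ := exists_child_below hx (Ne.symm hxv)
      rw [hch] at hz
      rcases hz with rfl | rfl
      · exact ha.2.1 x hzx
      · exact hb.2.1 x hzx
  · obtain ⟨w, hw, hwf, hsw⟩ := hTe s hs
    have := hsub hw hwf s hsw _ h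
    exact not_below_par hv ((hmem hw).1.trans this)
  · obtain ⟨w, hw, hwf, hsw⟩ := hTe s hs
    have hs' := hsub hw hwf s hsw
    have := hwf.2.2.2.2 s hsw
    rw [oddOf_eq hv (hmem hw).1 (hmem hw).2 (H hw hwf) D hsw, hVs hw hwf s hsw,
      hval_eq hv (hmem hw).1 hs', hval_eq hv (hmem hw).1 hs'] at this
    exact this

theorem Vf_congr {f f' : V → ℕ} (h : ∀ x, R.below w x → f x = f' x) (hs : s ∈ R.Ve w) :
    R.Vf w f s = R.Vf w f' s := by
  have key : ∀ {z x y}, z ∈ R.Ve w → R.below z x → x ≠ z → y ∈ R.Ve w → R.below x y →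
      f x = f' x := by
    rintro z x y (rfl | hz) hzx hne (rfl | hy) hxy
    · exact absurd (hxy.antisymm hzx) hne
    · exact h x (below.of_par hy hzx hxy hne)
    · exact h x (hz.trans hzx)
    · exact h x (hz.trans hzx)
  ext y
  refine and_congr_right fun hy => exists_congr fun z => and_congr_right fun hz =>
    and_congr_right fun _ => and_congr_right fun _ => and_congr ?_ ?_
  · refine forall_congr' fun x => forall_congr' fun h1 => forall_congr' fun h2 =>
      forall_congr' fun h3 => ?_
    rw [key hz h1 h3 hs h2]
  · refine forall_congr' fun x => forall_congr' fun h1 => forall_congr' fun h2 =>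
      forall_congr' fun h3 => ?_
    rw [key hz h1 h3 hy h2]

theorem IsBlocking.congr {f f' : V → ℕ} (h : ∀ x, R.below w x → f x = f' x)
    (hf : R.IsBlocking w f) : R.IsBlocking w f' := by
  obtain ⟨⟨g, hg1, hg2⟩, h2, h3, h4, h5⟩ := hf
  have hV : ∀ s ∈ R.Te w, R.Vf w f s = R.Vf w f' s := fun s hs =>
    Vf_congr h (mem_Ve_of_mem_Te hs)
  have hU : R.UT w f = R.UT w f' := Set.iUnion₂_congr hV
  have hh : ∀ X, R.hval w X f = R.hval w X f' := fun X =>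
    finsum_mem_congr rfl fun x hx => h x hx.1
  refine ⟨⟨g, hg1, fun x hx => by rw [← h x hx, hg2 x hx]⟩, fun x hx => by
    rw [← h x hx]; exact h2 x hx, fun s hs => by rw [← hV s hs]; exact h3 s hs,
    fun s hs s' hs' hss => by rw [← hV s hs, ← hV s' hs']; exact h4 s hs s' hs' hss,
    fun s hs => ?_⟩
  rw [← hV s hs, ← hU, ← hh, ← h s hs.1]
  exact h5 s hs

theorem exists_cutE_crosses {X : Set V} (hv : v ≠ R.root) (ha : a ∈ R.S v) (hb : b ∈ R.S v)
    (haX : a ∈ X) (hbX : b ∉ X) : ∃ y ∈ R.cutE v X, R.Crosses y s(a, b) := by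
  obtain ⟨z, hz, hza, hzb, hlca⟩ := exists_lca (mem_S_below hv ha) (mem_S_below hv hb)
  have hcut : ∀ {y x}, x ∈ R.S v → R.below z y → y ≠ z → R.below y x →
      ¬ (y ∈ X ↔ R.par y ∈ X) → y ∈ R.cutE v X := by
    intro y x hx hzy hne hyx hX
    refine ⟨?_, hX⟩
    have hne' : y ≠ R.par v := by
      rintro rfl
      exact hne (hz.antisymm hzy)
    rcases hx with rfl | hx
    · exact absurd (hyx.antisymm (hz.trans hzy)) hne'
    · exact hx.1.of_par (hz.trans hzy) hyx hne'
  by_cases hzX : z ∈ X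
  · obtain ⟨y, h1, h2, h3, h4⟩ := hzb.exists_cut (X := X) (by tauto)
    exact ⟨y, hcut hb h1 h2 h3 h4,
      crosses_mk.2 fun h => h2 ((hlca y (h.2 h3) h3).antisymm h1)⟩
  · obtain ⟨y, h1, h2, h3, h4⟩ := hza.exists_cut (X := X) (by tauto)
    exact ⟨y, hcut ha h1 h2 h3 h4,
      crosses_mk.2 fun h => h2 ((hlca y h3 (h.1 h3)).antisymm h1)⟩

/-- A path that meets a connected set `X` without starting in it uses an edge of the cut of `X`. -/
theorem exists_cutE_crosses_of_touch {X : Set V} (hvy : R.below v y)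
    (hyX : y ∈ X ∨ R.par y ∈ X) (hcr : R.Crosses y s(a, b)) (haX : a ∉ X) (hbX : b ∉ X) :
    ∃ y' ∈ R.cutE v X, R.Crosses y' s(a, b) := by
  by_cases hy : y ∈ X
  · have key : ∀ {a b}, a ∉ X → R.below y a → ¬ R.below y b →
        ∃ y' ∈ R.cutE v X, R.Crosses y' s(a, b) := by
      intro a b haX hya hyb
      obtain ⟨x, h1, h2, h3, h4⟩ := hya.exists_cut (X := X) (by tauto)
      exact ⟨x, ⟨hvy.trans h1, h4⟩, crosses_mk.2 fun h => hyb (h1.trans (h.1 h3))⟩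
    have h := crosses_mk.1 hcr
    by_cases hya : R.below y a
    · exact key haX hya (by tauto)
    · rw [Sym2.eq_swap]
      exact key hbX (by tauto) hya
  · exact ⟨y, ⟨hvy, by tauto⟩, hcr⟩

theorem IsBlocking.mem_of_crosses [Fintype V] {f : V → ℕ} {g : Sym2 V → ℕ}
    (hf : R.IsBlocking v f) (hv : v ≠ R.root) (hg : R.IsDecomp v f g) (ht : t ∈ R.Te v)
    (hvy : R.below v y) (hyX : y ∈ R.Vf v f t ∨ R.par y ∈ R.Vf v f t) {p : Sym2 V}
    (hp : g p ≠ 0) (hcr : R.Crosses y p) : t ∈ p := by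
  obtain ⟨_, _, h3, h4, h5⟩ := hf
  have hg' := isDecomp_iff.1 hg
  set X := R.Vf v f t with hX
  have hout : ∀ x ∈ R.S v, x ≠ t → x ∉ X := by
    rintro x (rfl | hx) hxt h
    · exact h3 t ht h
    · exact Set.eq_empty_iff_forall_notMem.1 (h4 x hx t ht hxt) x
        ⟨self_mem_Vf (mem_Ve_of_mem_Te hx), h⟩
  have hin : t ∈ X := self_mem_Vf (mem_Ve_of_mem_Te ht)
  let F : Finset V := Finset.univ.filter fun x => x ∈ R.cutE v X
  have hF : ∀ {x}, x ∈ F ↔ x ∈ R.cutE v X := by simp [F]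
  have hval : R.hval v X f = ∑ p : Sym2 V, ∑ x ∈ F, if R.Crosses x p then g p else 0 := by
    rw [Finset.sum_comm, hval, ← finsum_mem_coe_finset]
    have : (F : Set V) = R.cutE v X := by
      ext x
      exact hF
    rw [this]
    exact finsum_mem_congr rfl fun x hx => hg'.2 x hx.1
  have hle : ∀ p ∈ (Finset.univ : Finset (Sym2 V)), (if R.Crosses t p then g p else 0)
      ≤ ∑ x ∈ F, if R.Crosses x p then g p else 0 := by
    intro p _
    split_ifs with h
    · by_cases hgp : g p = 0
      · simp [hgp]
      obtain ⟨a, b, ha, hb, hab, rfl⟩ := hg'.1 p hgp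
      have hcut : ∃ x ∈ R.cutE v X, R.Crosses x s(a, b) := by
        have hab' := crosses_mk.1 h
        by_cases hta : R.below t a
        · obtain rfl := ht.2.eq_of_below hta
          exact exists_cutE_crosses hv ha hb hin (hout b hb hab.symm)
        · have htb : R.below t b := by tauto
          obtain rfl := ht.2.eq_of_below htb
          rw [Sym2.eq_swap]
          exact exists_cutE_crosses hv hb ha hin (hout a ha hab)
      obtain ⟨x, hx, hxp⟩ := hcut
      refine le_trans ?_ (Finset.single_le_sum (fun _ _ => Nat.zero_le _) (hF.2 hx))
      rw [if_pos hxp]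
    · exact Nat.zero_le _
  have heq := (Finset.sum_eq_sum_iff_of_le hle).1
    (by rw [← hval, ← (h5 t ht).1, hg'.2 t ht.1]) p (Finset.mem_univ p)
  by_contra htp
  obtain ⟨a, b, ha, hb, -, rfl⟩ := hg'.1 p hp
  rw [Sym2.mem_iff, not_or] at htp
  obtain ⟨x, hx, hxp⟩ := exists_cutE_crosses_of_touch hvy hyX hcr
    (hout a ha (Ne.symm htp.1)) (hout b hb (Ne.symm htp.2))
  rw [if_neg] at heq
  · have := Finset.single_le_sum (f := fun x => if R.Crosses x s(a, b) then g s(a, b) else 0)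
      (fun _ _ => Nat.zero_le _) (hF.2 hx)
    simp only [if_pos hxp] at this
    omega
  · rw [crosses_mk, not_not]
    exact iff_of_false (fun h => htp.1 (ht.2.eq_of_below h).symm)
      fun h => htp.2 (ht.2.eq_of_below h).symm

/-! ### Gluing flows of the child-instances -/

theorem sum_crosses_eq [Fintype V] {f : V → ℕ} {g : Sym2 V → ℕ} (ha : a ≠ R.root)
    (hg : R.IsDecomp a f g) (hx : R.below a x) :
    f x = (∑ p : Sym2 V, if R.Crosses x p then (if R.par a ∈ p then 0 else g p) else 0)
      + ∑ t : V, if R.below x t then g s(R.par a, t) else 0 := by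
  have hg' := isDecomp_iff.1 hg
  have hx' : ¬ R.below x (R.par a) := fun h => not_below_par ha (hx.trans h)
  have h1 : ∑ t : V, (if R.below x t then g s(R.par a, t) else 0)
      = ∑ p : Sym2 V, if R.Crosses x p then (if R.par a ∈ p then g p else 0) else 0 := by
    have hinj : Function.Injective fun t : V => s(R.par a, t) := fun t t' h =>
      Sym2.congr_right.1 h
    rw [← Finset.sum_subset (Finset.subset_univ (Finset.univ.image fun t : V => s(R.par a, t))),
      Finset.sum_image fun _ _ _ _ h => hinj h]
    · refine Finset.sum_congr rfl fun t _ => ?_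
      have : R.Crosses x s(R.par a, t) ↔ R.below x t := by
        rw [crosses_mk]
        tauto
      simp [this]
    · intro p _ hp
      rw [if_neg (c := R.par a ∈ p), ite_self]
      rintro ⟨t, rfl⟩
      exact hp (Finset.mem_image_of_mem _ (Finset.mem_univ t))
  rw [h1, ← Finset.sum_add_distrib, hg'.2 x hx]
  refine Finset.sum_congr rfl fun p _ => ?_
  split_ifs <;> simp

/-- A pair of terminals on one side of `par a` only uses edges strictly below `a`. -/
theorem eq_zero_of_crosses {f : V → ℕ} {g : Sym2 V → ℕ}
    (hg : R.IsDecomp a f g) (hx : R.below a x → x = a) {p : Sym2 V} (hcr : R.Crosses x p) :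
    (if R.par a ∈ p then 0 else g p) = 0 := by
  by_contra h
  rw [ite_eq_left_iff, Classical.not_imp] at h
  obtain ⟨c, d, hc, hd, -, rfl⟩ := hg.1 _ h.2
  rw [Sym2.mem_iff, not_or] at h
  have hc' := (hc.resolve_left (Ne.symm h.1.1)).1
  have hd' := (hd.resolve_left (Ne.symm h.1.2)).1
  refine crosses_mk.1 hcr ?_
  by_cases hxa : R.below x a
  · exact iff_of_true (hxa.trans hc') (hxa.trans hd')
  · have key : ∀ {c}, R.below a c → ¬ R.below x c := fun hc h => by
      rcases hc.total h with h' | h'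
      · exact hxa (hx h' ▸ below_refl _)
      · exact hxa h'
    exact iff_of_false (key hc') (key hd')

theorem sum_inner_eq_zero [Fintype V] {f : V → ℕ} {g : Sym2 V → ℕ}
    (hg : R.IsDecomp a f g) (hx : R.below a x → x = a) :
    (∑ p : Sym2 V, if R.Crosses x p then (if R.par a ∈ p then 0 else g p) else 0) = 0 := by
  refine Finset.sum_eq_zero fun p _ => ?_
  by_cases h : R.Crosses x p
  · rw [if_pos h, eq_zero_of_crosses hg hx h]
  · rw [if_neg h]

/-- The path-ends at `par a` of a decomposition in `I(e)`, `e = (par a, a)`, each repeated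
according to its multiplicity. -/
abbrev Ends (R : RTI V) (a : V) (g : Sym2 V → ℕ) : Type _ := Σ t : V, Fin (g s(R.par a, t))

theorem Ends.mem_Te {f : V → ℕ} {g : Sym2 V → ℕ} (hg : R.IsDecomp a f g) (e : R.Ends a g) :
    e.1 ∈ R.Te a := by
  obtain ⟨t, i⟩ := e
  have hpos : g s(R.par a, t) ≠ 0 := fun h => by rw [h] at i; exact i.elim0
  obtain ⟨c, d, hc, hd, hcd, h⟩ := hg.1 _ hpos
  rcases Sym2.eq_iff.1 h with ⟨rfl, rfl⟩ | ⟨rfl, rfl⟩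
  · exact hd.resolve_left hcd.symm
  · exact hc.resolve_left hcd

theorem sum_crosses_eq_ends [Fintype V] {f : V → ℕ} {g : Sym2 V → ℕ} (ha : a ≠ R.root)
    (hg : R.IsDecomp a f g) (hx : R.below a x) :
    f x = (∑ p : Sym2 V, if R.Crosses x p then (if R.par a ∈ p then 0 else g p) else 0)
      + ∑ e : R.Ends a g, if R.below x e.1 then 1 else 0 := by
  rw [sum_crosses_eq ha hg hx, Fintype.sum_sigma]
  congr 1
  refine Finset.sum_congr rfl fun t _ => ?_
  dsimp only
  split_ifs <;> simp

theorem card_ends [Fintype V] {f : V → ℕ} {g : Sym2 V → ℕ} (ha : a ≠ R.root)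
    (hg : R.IsDecomp a f g) : Fintype.card (R.Ends a g) = f a := by
  rw [sum_crosses_eq_ends ha hg (below_refl a), sum_inner_eq_zero hg fun _ => rfl,
    Finset.sum_congr rfl fun e _ => if_pos (Ends.mem_Te hg e).1]
  simp

theorem exists_glued_flow [Fintype V] {f₁ f₂ : V → ℕ} (hv : v ≠ R.root) (hab : a ≠ b)
    (hch : R.children v = {a, b}) (h₁ : R.IsFlow a f₁) (h₂ : R.IsFlow b f₂)
    (hle : f₂ b ≤ f₁ a) :
    ∃ f, R.IsFlow v f ∧ f v = f₁ a - f₂ b ∧ (∀ x, R.below a x → f₁ x = f x) ∧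
      ∀ x, R.below b x → f₂ x = f x := by
  obtain ⟨g₁, hg₁⟩ := h₁
  obtain ⟨g₂, hg₂⟩ := h₂
  obtain ⟨hpa, ha⟩ : a ∈ R.children v := by rw [hch]; exact Or.inl rfl
  obtain ⟨hpb, hb⟩ : b ∈ R.children v := by rw [hch]; exact Or.inr rfl
  have hva : R.below v a := by simpa [hpa] using below_par_self ha
  have hvb : R.below v b := by simpa [hpb] using below_par_self hb
  have hav : ¬ R.below a v := by simpa [hpa] using not_below_par ha
  have hbv : ¬ R.below b v := by simpa [hpb] using not_below_par hb
  have hdis : ∀ {x}, R.below a x → ¬ R.below b x :=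
    fun h => not_below_of_sibling hb hab (hpa.trans hpb.symm) ha h
  obtain ⟨k, hk⟩ := Nat.exists_eq_add_of_le hle
  obtain ⟨σ⟩ : Nonempty (R.Ends b g₂ ⊕ Fin k ≃ R.Ends a g₁) := by
    rw [← Fintype.card_eq, Fintype.card_sum, card_ends ha hg₁, card_ends hb hg₂, Fintype.card_fin,
      hk]
  let f : V → ℕ := fun x => if R.below a x then f₁ x else if R.below b x then f₂ x else k
  have hfa : ∀ x, R.below a x → f x = f₁ x := fun x hx => if_pos hx
  have hfb : ∀ x, R.below b x → f x = f₂ x := fun x hx => by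
    simp only [f]
    rw [if_neg fun h => hdis h hx, if_pos hx]
  have hfv : f v = k := by
    simp only [f]
    rw [if_neg hav, if_neg hbv]
  have hTa : ∀ e : R.Ends a g₁, e.1 ∈ R.Te a := Ends.mem_Te hg₁
  have hTb : ∀ e : R.Ends b g₂, e.1 ∈ R.Te b := Ends.mem_Te hg₂
  refine ⟨f, isFlow_of_family
    (ι := Sym2 V ⊕ Sym2 V ⊕ R.Ends b g₂ ⊕ Fin k)
    (Sum.elim (fun p => if R.par a ∈ p then 0 else g₁ p)
      (Sum.elim (fun p => if R.par b ∈ p then 0 else g₂ p) fun _ => 1))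
    (Sum.elim id (Sum.elim id (Sum.elim (fun e => s((σ (Sum.inl e)).1, e.1))
      fun i => s(R.par v, (σ (Sum.inr i)).1)))) ?_ ?_,
    by rw [hfv, hk]; omega, fun x hx => (hfa x hx).symm, fun x hx => (hfb x hx).symm⟩
  · rintro (p | p | e | i) h
    · simp only [Sum.elim_inl, ne_eq, ite_eq_left_iff, Classical.not_imp] at h
      obtain ⟨c, d, hc, hd, hcd, rfl⟩ := hg₁.1 _ h.2
      rw [Sym2.mem_iff, not_or] at h
      exact ⟨c, d, Or.inr (Te_mono hva (hc.resolve_left (Ne.symm h.1.1))),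
        Or.inr (Te_mono hva (hd.resolve_left (Ne.symm h.1.2))), hcd, rfl⟩
    · simp only [Sum.elim_inl, Sum.elim_inr, ne_eq, ite_eq_left_iff, Classical.not_imp] at h
      obtain ⟨c, d, hc, hd, hcd, rfl⟩ := hg₂.1 _ h.2
      rw [Sym2.mem_iff, not_or] at h
      exact ⟨c, d, Or.inr (Te_mono hvb (hc.resolve_left (Ne.symm h.1.1))),
        Or.inr (Te_mono hvb (hd.resolve_left (Ne.symm h.1.2))), hcd, rfl⟩
    · refine ⟨_, _, Or.inr (Te_mono hva (hTa (σ (Sum.inl e)))), Or.inr (Te_mono hvb (hTb e)),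
        ?_, rfl⟩
      intro h'
      exact hdis (hTa (σ (Sum.inl e))).1 (h' ▸ (hTb e).1)
    · have := Te_mono hva (hTa (σ (Sum.inr i)))
      exact ⟨_, _, Or.inl rfl, Or.inr this, (par_notMem_below hv this.1).symm, rfl⟩
  · intro x hx
    have hxu : ¬ R.below x (R.par v) := fun h => not_below_par hv (hx.trans h)
    rw [Fintype.sum_sum_type, Fintype.sum_sum_type, Fintype.sum_sum_type]
    change f x = (∑ p : Sym2 V, if R.Crosses x p then (if R.par a ∈ p then 0 else g₁ p) else 0)
      + ((∑ p : Sym2 V, if R.Crosses x p then (if R.par b ∈ p then 0 else g₂ p) else 0)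
        + ((∑ e : R.Ends b g₂, if R.Crosses x s((σ (Sum.inl e)).1, e.1) then 1 else 0)
          + ∑ i : Fin k, if R.Crosses x s(R.par v, (σ (Sum.inr i)).1) then 1 else 0))
    by_cases hxv : x = v
    · subst hxv
      rw [sum_inner_eq_zero hg₁ fun h => absurd h hav,
        sum_inner_eq_zero hg₂ fun h => absurd h hbv, hfv]
      simp [crosses_mk, hxu, hva.trans (hTa _).1, hvb.trans (hTb _).1]
    · obtain ⟨z, hz, hzx⟩ := exists_child_below hx (Ne.symm hxv)
      rw [hch] at hz
      rcases hz with rfl | rfl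
      · have hxb : ∀ e : R.Ends b g₂, ¬ R.below x e.1 := fun e h =>
          hdis (hzx.trans h) (hTb e).1
        rw [sum_inner_eq_zero hg₂ fun h => absurd h (hdis hzx), hfa x hzx,
          sum_crosses_eq_ends ha hg₁ hzx, ← Equiv.sum_comp σ, Fintype.sum_sum_type]
        simp [crosses_mk, hxu, hxb]
      · have hxa : ∀ e : R.Ends a g₁, ¬ R.below x e.1 := fun e h =>
          hdis (hTa e).1 (hzx.trans h)
        rw [sum_inner_eq_zero hg₁ fun h => absurd hzx (hdis h), hfb x hzx,
          sum_crosses_eq_ends hb hg₂ hzx]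
        simp [crosses_mk, hxu, hxa]

/-! ### The values of blocking flows -/

theorem cap_mem_Psi (hx : x ≠ R.root) (h : R.CondA x) : R.c x ∈ R.Psi x := by
  by_cases hl : R.leaf x
  · rw [h.2.1 hl]; rfl
  · obtain ⟨a, b, hab, hch⟩ := exists_children_of_not_leaf hx hl
    rw [h.2.2 a b hab hch]
    exact Or.inr rfl

theorem le_cap_of_mem_Psi {n : ℕ} (h : n ∈ R.Psi x) : n ≤ R.c x := by
  obtain ⟨f, hf, rfl⟩ := h
  exact hf.2.1 x (below_refl _)

theorem bE_eq (hx : x ≠ R.root) (h : R.CondA x) : R.bE x = R.c x :=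
  IsGreatest.csSup_eq ⟨cap_mem_Psi hx h, fun _ => le_cap_of_mem_Psi⟩

theorem aE_le {n : ℕ} (h : n ∈ R.Psi x) : R.aE x ≤ n := Nat.sInf_le h

theorem aE_mem (hx : x ≠ R.root) (h : R.CondA x) : R.aE x ∈ R.Psi x :=
  Nat.sInf_mem ⟨_, cap_mem_Psi hx h⟩

theorem CondA.mem_Psi_iff (hx : x ≠ R.root) (h : R.CondA x) {n : ℕ} :
    n ∈ R.Psi x ↔ R.aE x ≤ n ∧ n ≤ R.c x ∧ n % 2 = R.c x % 2 := by
  obtain ⟨⟨p, q, hpq⟩, -⟩ := id h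
  have h1 := cap_mem_Psi hx h
  have h2 := aE_mem hx h
  have h3 : p ∈ R.Psi x := by
    rw [hpq] at h1 ⊢
    exact ⟨le_rfl, h1.1.trans h1.2.1, rfl⟩
  have h4 := aE_le h3
  constructor
  · intro hn
    refine ⟨aE_le hn, le_cap_of_mem_Psi hn, ?_⟩
    rw [hpq] at hn h1
    rw [hn.2.2, h1.2.2]
  · rintro ⟨h5, h6, h7⟩
    rw [hpq] at h1 h2 ⊢
    obtain ⟨h8, h9, h10⟩ := h1
    obtain ⟨h11, -⟩ := h2
    exact ⟨by omega, by omega, by omega⟩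

theorem mem_otimes_of_le {A B : Set ℕ} {m n : ℕ} (hm : m ∈ A) (hn : n ∈ B) (h : n ≤ m) :
    m - n ∈ otimes A B :=
  ⟨m, hm, n, hn, n, by simp [h], by omega⟩

theorem mem_otimes_of_le' {A B : Set ℕ} {m n : ℕ} (hm : m ∈ A) (hn : n ∈ B) (h : m ≤ n) :
    n - m ∈ otimes A B :=
  ⟨m, hm, n, hn, m, by simp [h], by omega⟩

theorem exists_le_one_mem_otimes (ha : a ≠ R.root) (hb : b ≠ R.root) (hA : R.CondA a)
    (hB : R.CondA b) (h1 : R.aE a < R.bE b + 2) (h2 : R.aE b < R.bE a + 2) :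
    ∃ n ∈ otimes (R.Psi a) (R.Psi b), n ≤ 1 := by
  rw [bE_eq hb hB] at h1
  rw [bE_eq ha hA] at h2
  have h3 := (hA.mem_Psi_iff ha).1 (aE_mem ha hA)
  have h4 := (hB.mem_Psi_iff hb).1 (aE_mem hb hB)
  rcases le_total (R.aE a) (R.aE b) with h | h
  · have h5 : R.aE a + 2 * ((R.aE b - R.aE a) / 2) ∈ R.Psi a :=
      (hA.mem_Psi_iff ha).2 ⟨by omega, by omega, by omega⟩
    exact ⟨_, mem_otimes_of_le' h5 (aE_mem hb hB) (by omega), by omega⟩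
  · have h5 : R.aE b + 2 * ((R.aE a - R.aE b) / 2) ∈ R.Psi b :=
      (hB.mem_Psi_iff hb).2 ⟨by omega, by omega, by omega⟩
    exact ⟨_, mem_otimes_of_le (aE_mem ha hA) h5 (by omega), by omega⟩

theorem dominating_of_pair (ha : a ∈ R.children v) (hb : b ∈ R.children v) (hab : a ≠ b)
    (h : R.bE b + 2 ≤ R.aE a) : R.Dominating a :=
  ⟨ha.2, b, hb.2, hab.symm, hb.1.trans ha.1.symm, h⟩

theorem Dominating.bE_add_two_le (hv : v ≠ R.root) (ha : a ∈ R.children v)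
    (hb : b ∈ R.children v) (hab : a ≠ b) (h : R.Dominating a) : R.bE b + 2 ≤ R.aE a := by
  obtain ⟨_, y, hy, hya, hp, h⟩ := h
  have hy' : y ∈ R.children v := ⟨hp.trans ha.1, hy⟩
  rw [children_eq_pair hv ha hb hab] at hy'
  rcases hy' with rfl | rfl
  · exact absurd rfl hya
  · exact h

theorem dominating_or_exists_le_one (ha : a ∈ R.children v) (hb : b ∈ R.children v)
    (hab : a ≠ b) (hA : R.CondA a) (hB : R.CondA b) :
    (R.Dominating a ∨ R.Dominating b) ∨ ∃ n ∈ otimes (R.Psi a) (R.Psi b), n ≤ 1 := by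
  by_cases h1 : R.bE b + 2 ≤ R.aE a
  · exact Or.inl (Or.inl (dominating_of_pair ha hb hab h1))
  by_cases h2 : R.bE a + 2 ≤ R.aE b
  · exact Or.inl (Or.inr (dominating_of_pair hb ha hab.symm h2))
  · exact Or.inr (exists_le_one_mem_otimes ha.2 hb.2 hA hB (by omega) (by omega))

theorem dep_child (h : a ∈ R.children v) : R.dep a = R.dep v + 1 := by
  rw [R.dep_par a h.2, h.1]

/-- If every blocking flow uses the edge `(par w, w)` at least twice, then one terminal
receives at least `a(e)` units of flow from `par w`. -/
theorem exists_terminal_of_two_le_aE [Fintype V] (hw : w ≠ R.root)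
    (hind : ∀ x, x ≠ R.root → R.dep w ≤ R.dep x → R.CondA x ∧ R.CondB x) (h2 : 2 ≤ R.aE w) :
    ∃ t ∈ R.Te w, R.DomPath w t ∧ ∀ f g, R.IsBlocking w f → R.IsDecomp w f g →
      R.aE w ≤ g s(R.par w, t) := by
  obtain ⟨hA, hB⟩ := hind w hw le_rfl
  by_cases hl : R.leaf w
  · refine ⟨w, ⟨below_refl _, hl⟩, ⟨below_refl _, fun x h h' hne =>
      absurd (h'.antisymm h) hne⟩, fun f g hf hg => ?_⟩
    rw [← hl.eq_decomp hg]
    exact aE_le ⟨f, hf, rfl⟩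
  · obtain ⟨a, b, hab, hch⟩ := exists_children_of_not_leaf hw hl
    have ha : a ∈ R.children w := by rw [hch]; exact Or.inl rfl
    have hb : b ∈ R.children w := by rw [hch]; exact Or.inr rfl
    have hdep : ∀ {x}, x ∈ R.children w → R.dep w ≤ R.dep x := fun hx => by
      rw [dep_child hx]; omega
    have key : ∃ y ∈ R.children w, R.Dominating y := by
      rcases dominating_or_exists_le_one ha hb hab (hind a ha.2 (hdep ha)).1
        (hind b hb.2 (hdep hb)).1 with (h | h) | ⟨n, hn, hn1⟩
      · exact ⟨a, ha, h⟩
      · exact ⟨b, hb, h⟩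
      · have hc := R.cap_pos w hw
        have : n ∈ R.Psi w := by
          rw [hA.2.2 a b hab hch]
          exact Or.inl ⟨hn, show n ≤ R.c w by omega⟩
        have := aE_le this
        omega
    obtain ⟨y, hy, hyd⟩ := key
    obtain ⟨t, ht, h⟩ := hB y hy hyd
    refine ⟨t, Te_mono ?_ ht, h⟩
    simpa [hy.1] using below_par_self hy.2

/-- If the terminal set of `t` reaches `v`, then a dominating path from `v` to a terminal
has to end in `t`. -/
theorem DomPath.eq_of_mem_Vf [Fintype V] {f : V → ℕ} (hv : v ≠ R.root)
    (hA : ∀ x, x ≠ R.root → R.dep v < R.dep x → R.CondA x) (hf : R.IsBlocking v f)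
    (ht : t ∈ R.Te v) (hvt : v ∈ R.Vf v f t) (hs : s ∈ R.Te v) (hd : R.DomPath v s) :
    s = t := by
  suffices h : ∀ x, R.below v x → R.below x s → R.below x t from
    (hs.2.eq_of_below (h s hs.1 (below_refl _))).symm
  intro x hx
  induction hx with
  | refl => exact fun _ => ht.1
  | @tail x y hx hxy ih =>
    intro hys
    have hvx : R.below v x := hx
    have hxr := hvx.ne_root hv
    have hy : y ∈ R.children x := hxy
    have hxy' : R.below x y := Relation.ReflTransGen.single hxy
    have hvy : R.below v y := hvx.trans hxy'
    have hyv : y ≠ v := by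
      rintro rfl
      have := not_below_par hy.2
      rw [hy.1] at this
      exact this hvx
    have hxt : R.below x t := ih (hxy'.trans hys)
    have hne : x ≠ t := by
      rintro rfl
      exact ht.2.notMem_children hy
    obtain ⟨z, hz, hzt⟩ := exists_child_below hxt hne
    by_cases hyz : y = z
    · rwa [hyz]
    exfalso
    have hdom := (hd.2 y hvy hys hyv).bE_add_two_le hxr hy hz hyz
    have hdep := hvx.dep_le
    have hAz := hA z hz.2 (by rw [dep_child hz]; omega)
    rw [bE_eq hz.2 hAz] at hdom
    have hxX : x ∈ R.Vf v f t := mem_Vf_of_between hvt hvx hxt (Or.inr hvx)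
    have hpar : R.par y = R.par z := hy.1.trans hz.1.symm
    have hyt : ¬ R.below y t := fun h => not_below_of_sibling hz.2 hyz hpar hy.2 h hzt
    have hby : R.IsBlocking y f := by
      refine hf.restrict hv hvy hyv fun s hs h => ?_
      rw [hy.1] at h
      have hst : s ≠ t := by
        rintro rfl
        exact hyt hs.1
      exact Set.eq_empty_iff_forall_notMem.1
        (hf.2.2.2.1 s (Te_mono hvy hs) t ht hst) x ⟨h, hxX⟩
    have h1 := aE_le ⟨f, hby, rfl⟩
    have hvz : R.below v z := hvx.trans (by simpa [hz.1] using below_par_self hz.2)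
    have h2 := hf.2.1 z hvz
    obtain ⟨g, hg⟩ := hf.1
    have hg' := isDecomp_iff.1 hg
    have h3 : f y ≤ f z := by
      rw [hg'.2 y hvy, hg'.2 z hvz]
      refine Finset.sum_le_sum fun p _ => ?_
      split_ifs with hc hc'
      · exact le_rfl
      · by_contra hgp
        have htp := hf.mem_of_crosses hv hg ht hvy (Or.inr (by rwa [hy.1]))
          (p := p) (by omega) hc
        obtain ⟨u, rfl⟩ := htp
        rw [crosses_mk] at hc hc'
        have hyu : R.below y u := by tauto
        exact hc' fun h =>
          not_below_of_sibling hz.2 hyz hpar hy.2 hyu (h.1 hzt)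
      · exact Nat.zero_le _
      · exact le_rfl
    omega

theorem exists_dominating_terminal [Fintype V] (hv : v ≠ R.root) (hab : a ≠ b)
    (hch : R.children v = {a, b})
    (hind : ∀ x, x ≠ R.root → R.dep v < R.dep x → R.CondA x ∧ R.CondB x)
    (hdom : R.Dominating a) :
    ∃ t ∈ R.Te a, R.DomPath v t ∧ ∀ f g, R.IsBlocking v f → R.IsDecomp v f g →
      (f v = R.c v ∧ f v = g s(R.par v, t)) ∨ R.aE a - R.c b ≤ g s(R.par v, t) := by
  have ha : a ∈ R.children v := by rw [hch]; exact Or.inl rfl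
  have hb : b ∈ R.children v := by rw [hch]; exact Or.inr rfl
  have hda := dep_child ha
  have hdb := dep_child hb
  have h2 := hdom.bE_add_two_le hv ha hb hab
  have hva : R.below v a := by simpa [ha.1] using below_par_self ha.2
  have hvb : R.below v b := by simpa [hb.1] using below_par_self hb.2
  have hav : a ≠ v := by
    rintro rfl
    omega
  obtain ⟨t, ht, htd, h⟩ := exists_terminal_of_two_le_aE ha.2
    (fun x hx hd => hind x hx (by omega)) (show 2 ≤ R.aE a by omega)
  have htv : R.DomPath v t := by
    refine ⟨hva.trans ht.1, fun x hvx hxt hne => ?_⟩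
    have hax : R.below a x := ht.1.of_par (by rwa [ha.1]) hxt (by rwa [ha.1])
    by_cases hxa : x = a
    · rwa [hxa]
    · exact htd.2 x hax hxt hxa
  refine ⟨t, ht, htv, fun f g hf hg => ?_⟩
  by_cases hX : ∃ s ∈ R.Te v, v ∈ R.Vf v f s
  · left
    obtain ⟨s, hs, hvs⟩ := hX
    obtain rfl : t = s := htv.eq_of_mem_Vf hv (fun x hx hd => (hind x hx hd).1) hf hs hvs
      (Te_mono hva ht)
    refine ⟨?_, eq_of_crosses_imp_mem hv hg hs fun p hp hc =>
      hf.mem_of_crosses hv hg hs (below_refl _) (Or.inl hvs) hp hc⟩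
    refine le_antisymm (hf.2.1 v (below_refl _)) ?_
    by_contra hlt
    refine hf.2.2.1 t hs ((par_mem_Vf_iff hv (below_refl _) hs.1).2 fun x hx hxt => ?_)
    by_cases hxv : x = v
    · rw [hxv]; omega
    · obtain ⟨_, z, _, _, hzv, h1, _⟩ := hvs
      refine h1 x (hzv.trans hx) hxt ?_
      rintro rfl
      exact hxv (hzv.antisymm hx)
  · right
    push Not at hX
    have hfa : R.IsBlocking a f := hf.restrict hv hva hav fun s hs => by
      rw [ha.1]
      exact hX s (Te_mono hva hs)
    have h3 := h f _ hfa (isDecomp_restrict hv hva hg)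
    rw [ha.1] at h3
    have h4 := restrictDecomp_le hab hch hg ht
    have h5 := hf.2.1 b hvb
    omega

theorem exists_terminal_aE_le [Fintype V] (hv : v ≠ R.root) (hab : a ≠ b)
    (hch : R.children v = {a, b})
    (hind : ∀ x, x ≠ R.root → R.dep v < R.dep x → R.CondA x ∧ R.CondB x)
    (hdom : R.Dominating a) :
    ∃ t ∈ R.Te a, R.DomPath v t ∧ ∀ f g, R.IsBlocking v f → R.IsDecomp v f g →
      R.aE v ≤ g s(R.par v, t) := by
  have ha : a ∈ R.children v := by rw [hch]; exact Or.inl rfl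
  have hb : b ∈ R.children v := by rw [hch]; exact Or.inr rfl
  have hA := (hind a ha.2 (by rw [dep_child ha]; omega)).1
  have hB := (hind b hb.2 (by rw [dep_child hb]; omega)).1
  obtain ⟨t, ht, htd, h⟩ := exists_dominating_terminal hv hab hch hind hdom
  have hva : R.below v a := by simpa [ha.1] using below_par_self ha.2
  refine ⟨t, ht, htd, fun f g hf hg => ?_⟩
  rcases h f g hf hg with ⟨_, h2⟩ | h1
  · rw [← h2]
    exact aE_le ⟨f, hf, rfl⟩
  · refine le_trans ?_ h1
    have hgf : g s(R.par v, t) ≤ f v :=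
      le_of_crosses hg (below_refl _) (crosses_par hv (below_refl _) (hva.trans ht.1))
    have hfc := hf.2.1 v (below_refl _)
    obtain ⟨f₁, hf₁, h₁⟩ := aE_mem ha.2 hA
    obtain ⟨f₂, hf₂, h₂⟩ := cap_mem_Psi hb.2 hB
    have hle := hdom.bE_add_two_le hv ha hb hab
    rw [bE_eq hb.2 hB] at hle
    obtain ⟨f', hf', hv', ha', hb'⟩ := exists_glued_flow hv hab hch hf₁.1 hf₂.1 (by omega)
    refine aE_le ⟨f', isBlocking_of_children hv hch hab hf' (by omega) (hf₁.congr ha')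
      (hf₂.congr hb'), by rw [hv', h₁, h₂]⟩

end RTI

/-- Main Lemma (ii): with the induction hypotheses of the Main Lemma,
if `c(e) < ã` then one of the child-edges `e₁, e₂` is dominating; moreover if `e₁`
(say) is dominating then there is a terminal `t* ∈ T_{e₁}` such that
`g(u,t*) ≥ min{ã, c(e)}` for every decomposition `g` of every blocking flow of
`I(e)` and `P_{v,t*}` is a dominating path; in particular `e` satisfies
condition (b). -/
theorem RTI.mainLemma_ii {V : Type*} [Fintype V] [DecidableEq V]
    (R : RTI V) (v : V) (hv : v ≠ R.root)
    (w₁ w₂ : V) (hw : w₁ ≠ w₂) (hch : R.children v = {w₁, w₂})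
    (hind : ∀ x, x ≠ R.root → R.dep v < R.dep x → R.CondA x ∧ R.CondB x)
    (ta tb : ℕ) (hab : otimes (R.Psi w₁) (R.Psi w₂) = Iv ta tb) :
    (R.c v < ta → R.Dominating w₁ ∨ R.Dominating w₂) ∧
    (R.Dominating w₁ → ∃ tstar ∈ R.Te w₁, R.DomPath v tstar ∧
      ∀ f g, R.IsBlocking v f → R.IsDecomp v f g →
        min ta (R.c v) ≤ g s(R.par v, tstar)) ∧
    R.CondB v := by
  have h₁ : w₁ ∈ R.children v := by rw [hch]; exact Or.inl rfl
  have h₂ : w₂ ∈ R.children v := by rw [hch]; exact Or.inr rfl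
  have hA₁ := (hind w₁ h₁.2 (by rw [dep_child h₁]; omega)).1
  have hA₂ := (hind w₂ h₂.2 (by rw [dep_child h₂]; omega)).1
  have hta : ∀ n ∈ otimes (R.Psi w₁) (R.Psi w₂), ta ≤ n := fun n hn => by
    rw [hab] at hn
    exact hn.1
  refine ⟨fun hc => ?_, fun hdom => ?_, ?_⟩
  · refine (dominating_or_exists_le_one h₁ h₂ hw hA₁ hA₂).resolve_right ?_
    rintro ⟨n, hn, hn1⟩
    have := hta n hn
    have := R.cap_pos v hv
    omega
  · obtain ⟨t, ht, htd, h⟩ := exists_dominating_terminal hv hw hch hind hdom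
    refine ⟨t, ht, htd, fun f g hf hg => ?_⟩
    rcases h f g hf hg with ⟨h3, h4⟩ | h3
    · omega
    · have hle := hdom.bE_add_two_le hv h₁ h₂ hw
      rw [bE_eq h₂.2 hA₂] at hle
      have := hta _ (mem_otimes_of_le (aE_mem h₁.2 hA₁) (cap_mem_Psi h₂.2 hA₂) (by omega))
      omega
  · intro w hwc hdom
    rw [hch] at hwc
    rcases hwc with rfl | rfl
    · exact exists_terminal_aE_le hv hw hch hind hdom
    · exact exists_terminal_aE_le hv hw.symm (by rw [hch, Set.pair_comm]) hind hdom
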